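/- A priori estimate: Let 0 < κ < μ < 1, ω > 0, z_a ∈ ℝ, and let F : [a,b] × ℝ → ℝ be continuous with |F(ℓ,y) − F(ℓ,x)| ≤ L|y − x| for all ℓ ∈ [a,b] and x, y ∈ ℝ, for some L > 0. Set F* = sup_{ℓ∈[a,b]} |F(ℓ,0)|. If z : [a,b] → ℝ is continuous and satisfies the integral equation z(ℓ) = z_a + ∫_a^ℓ Φ'(ρ)(Φ(ℓ)−Φ(ρ))^{μ−1} E_{μ−κ,μ}(−ω(Φ(ℓ)−Φ(ρ))^{μ−κ}) F(ρ, z(ρ)) dρ for all ℓ ∈ [a,b], then for every ℓ ∈ [a,b], |z(ℓ)| ≤ ( |z_a| + F* (Φ(b)−Φ(a))^μ / Γ(μ+1) ) · E_μ( L (Φ(b)−Φ(a))^μ ). -/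

import Mathlib

open Real MeasureTheory Set

/-- Two-parameter Mittag-Leffler function `E_{p,q}(x) = ∑_{k=0}^∞ x^k / Γ(pk+q)`;
the one-parameter function is `E_p = E_{p,1}`. -/
noncomputable def mittagLeffler (p q x : ℝ) : ℝ :=
  ∑' k : ℕ, x ^ k / Real.Gamma (p * k + q)

theorem integral_rpow_mul_sub_rpow {p q t : ℝ} (hp : 0 < p) (hq : 0 < q) (ht : 0 < t) :
    ∫ s in (0 : ℝ)..t, s ^ (p - 1) * (t - s) ^ (q - 1) =
      t ^ (p + q - 1) * (Gamma p * Gamma q / Gamma (p + q)) := by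
  have h := Complex.betaIntegral_scaled p q ht
  rw [Complex.betaIntegral_eq_Gamma_mul_div _ _ (by simpa) (by simpa),
    ← Complex.ofReal_add, Complex.Gamma_ofReal, Complex.Gamma_ofReal, Complex.Gamma_ofReal] at h
  apply Complex.ofReal_injective
  rw [← intervalIntegral.integral_ofReal]
  push_cast
  rw [Complex.ofReal_cpow ht.le]
  push_cast at h ⊢
  rw [← h, intervalIntegral.integral_of_le ht.le, intervalIntegral.integral_of_le ht.le]
  refine setIntegral_congr_fun measurableSet_Ioc fun x hx => ?_
  rw [Complex.ofReal_cpow hx.1.le, Complex.ofReal_cpow (sub_nonneg.2 hx.2)]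
  push_cast
  rfl

theorem intervalIntegrable_rpow_mul_sub_rpow {p q t : ℝ} (hp : 0 < p) (hq : 0 < q) (ht : 0 < t) :
    IntervalIntegrable (fun s : ℝ => s ^ (p - 1) * (t - s) ^ (q - 1)) volume 0 t := by
  by_contra hcon
  have h := integral_rpow_mul_sub_rpow hp hq ht
  rw [intervalIntegral.integral_undef hcon] at h
  have := Gamma_pos_of_pos hp
  have := Gamma_pos_of_pos hq
  have := Gamma_pos_of_pos (add_pos hp hq)
  have : 0 < t ^ (p + q - 1) * (Gamma p * Gamma q / Gamma (p + q)) := by positivity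
  linarith

theorem rpow_mul_exp_neg_le_Gamma {M s : ℝ} (hM : 0 < M) (hs : 1 ≤ s) :
    M ^ (s - 1) * exp (-(M + 1)) ≤ Gamma s := by
  rw [Gamma_eq_integral (by linarith)]
  have hint := GammaIntegral_convergent (s := s) (by linarith)
  calc M ^ (s - 1) * exp (-(M + 1)) = ∫ x in Ioc M (M + 1), M ^ (s - 1) * exp (-(M + 1)) := by
        simp
    _ ≤ ∫ x in Ioc M (M + 1), exp (-x) * x ^ (s - 1) := by
        refine setIntegral_mono_on (integrableOn_const (by simp)) (hint.mono_set fun x hx => hM.trans hx.1)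
          measurableSet_Ioc fun x hx => ?_
        rw [mul_comm]
        have := hx.1.le
        have := hx.2
        gcongr
    _ ≤ ∫ x in Ioi 0, exp (-x) * x ^ (s - 1) := by
        refine setIntegral_mono_set hint ?_ (LE.le.eventuallyLE fun x hx => hM.trans hx.1)
        filter_upwards [ae_restrict_mem measurableSet_Ioi] with x hx
        have : 0 < x := hx
        simp only [Pi.zero_apply]
        positivity

theorem summable_mittagLeffler {p q : ℝ} (hp : 0 < p) (hq : 0 < q) (x : ℝ) :
    Summable fun k : ℕ => x ^ k / Gamma (p * k + q) := by
  set M : ℝ := (2 * (|x| + 1)) ^ (1 / p) with hM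
  have hM0 : 0 < M := by positivity
  have hMp : M ^ p = 2 * (|x| + 1) := by
    rw [hM, ← rpow_mul (by positivity), one_div, inv_mul_cancel₀ hp.ne', rpow_one]
  refine Summable.of_norm_bounded_eventually_nat
    (g := fun k : ℕ => M ^ (1 - q) * exp (M + 1) * (1 / 2 : ℝ) ^ k)
    (summable_geometric_two.mul_left _) ?_
  obtain ⟨N, hN⟩ := exists_nat_gt (1 / p)
  filter_upwards [Filter.eventually_ge_atTop N] with k hk
  have hkN : (N : ℝ) ≤ k := by exact_mod_cast hk
  have h1 : 1 ≤ p * k + q := by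
    have := (div_lt_iff₀ hp).1 (hN.trans_le hkN)
    nlinarith
  have hG := rpow_mul_exp_neg_le_Gamma hM0 h1
  have hGpos : 0 < Gamma (p * k + q) := Gamma_pos_of_pos (by linarith)
  rw [norm_div, norm_pow, norm_eq_abs, norm_of_nonneg hGpos.le, div_le_iff₀ hGpos]
  have e1 : M ^ (p * k + q - 1) = (2 * (|x| + 1)) ^ k * M ^ (q - 1) := by
    rw [← hMp, ← rpow_natCast, ← rpow_mul hM0.le, ← rpow_add hM0]
    ring_nf
  rw [e1] at hG
  calc |x| ^ k ≤ (|x| + 1) ^ k := by gcongr; linarith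
    _ = M ^ (1 - q) * exp (M + 1) * (1 / 2 : ℝ) ^ k *
        ((2 * (|x| + 1)) ^ k * M ^ (q - 1) * exp (-(M + 1))) := by
      rw [exp_neg, mul_pow, show (1 : ℝ) - q = -(q - 1) by ring, rpow_neg hM0.le, one_div, inv_pow]
      field_simp
    _ ≤ _ := by gcongr

theorem continuous_mittagLeffler {p q : ℝ} (hp : 0 < p) (hq : 0 < q) :
    Continuous (mittagLeffler p q) := by
  refine continuous_iff_continuousAt.2 fun x => ?_
  have hc : ContinuousOn (mittagLeffler p q) (Metric.ball 0 (|x| + 1)) := by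
    unfold mittagLeffler
    refine continuousOn_tsum (fun k => by fun_prop)
      (summable_mittagLeffler hp hq (|x| + 1)) fun k y hy => ?_
    have hG : 0 < Gamma (p * k + q) := Gamma_pos_of_pos (by positivity)
    rw [norm_div, norm_pow, norm_of_nonneg hG.le]
    have : ‖y‖ ≤ |x| + 1 := by simpa using (mem_ball_zero_iff.1 hy).le
    gcongr
  exact hc.continuousAt (Metric.isOpen_ball.mem_nhds (by simp))

theorem mittagLeffler_zero_right {p q : ℝ} : mittagLeffler p q 0 = 1 / Gamma q := by
  unfold mittagLeffler
  rw [tsum_eq_single 0 fun k hk => by simp [hk]]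
  simp

theorem integral_mittagLeffler_mul_sub_rpow {p q t : ℝ} (hp : 0 < p) (hq : 0 < q) (ht : 0 < t) :
    ∫ s in (0 : ℝ)..t, s ^ (q - 1) * mittagLeffler p q (-s ^ p) * (t - s) ^ (p - 1) =
      Gamma p * (t ^ (q - 1) * (1 / Gamma q - mittagLeffler p q (-t ^ p))) := by
  have hk : ∀ k : ℕ, 0 < p * k + q := fun k => by positivity
  have hG : ∀ k : ℕ, 0 < Gamma (p * k + q) := fun k => Gamma_pos_of_pos (hk k)
  set f : ℕ → ℝ → ℝ := fun k s =>
    (-1) ^ k / Gamma (p * k + q) * (s ^ (p * k + q - 1) * (t - s) ^ (p - 1)) with hf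
  set c : ℕ → ℝ := fun k =>
    Gamma p * (t ^ (q - 1) * ((t ^ p) ^ (k + 1) / Gamma (p * (k + 1 : ℕ) + q))) with hc
  have hcs : ∀ x : ℝ, Summable fun k : ℕ => x ^ (k + 1) / Gamma (p * (k + 1 : ℕ) + q) := fun x =>
    (summable_nat_add_iff 1).2 (summable_mittagLeffler hp hq x)
  have hbeta : ∀ k : ℕ, (∫ s in Ioc 0 t, s ^ (p * k + q - 1) * (t - s) ^ (p - 1)) /
      Gamma (p * k + q) = c k := fun k => by
    have e : t ^ (p * k + q + p - 1) = t ^ (q - 1) * (t ^ p) ^ (k + 1) := by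
      rw [← rpow_natCast, ← rpow_mul ht.le, ← rpow_add ht]
      push_cast
      ring_nf
    rw [← intervalIntegral.integral_of_le ht.le, integral_rpow_mul_sub_rpow (hk k) hp ht, e, hc]
    have h1 := (hG k).ne'
    have e2 : p * k + q + p = p * (k + 1 : ℕ) + q := by push_cast; ring
    rw [e2]
    have h2 := (hG (k + 1)).ne'
    field_simp
  have hint : ∀ k, IntegrableOn (f k) (Ioc 0 t) := fun k =>
    ((intervalIntegrable_rpow_mul_sub_rpow (hk k) hp ht).1).const_mul _
  have hsum : Summable fun k => ∫ s in Ioc 0 t, ‖f k s‖ := by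
    refine (((hcs (t ^ p)).mul_left (t ^ (q - 1))).mul_left (Gamma p)).congr fun k => ?_
    change c k = _
    rw [← hbeta, ← integral_div]
    refine setIntegral_congr_fun measurableSet_Ioc fun s hs => ?_
    have h1 : 0 ≤ t - s := sub_nonneg.2 hs.2
    have h0 := hs.1.le
    simp only [hf, norm_mul, norm_div, norm_pow, norm_neg, norm_one, one_pow]
    rw [norm_of_nonneg (hG k).le, norm_of_nonneg (by positivity), norm_of_nonneg (by positivity)]
    ring
  have key := hasSum_integral_of_summable_integral_norm hint hsum
  have h1 : ∀ s ∈ Ioc 0 t, ∑' k, f k s =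
      s ^ (q - 1) * mittagLeffler p q (-s ^ p) * (t - s) ^ (p - 1) := fun s hs => by
    rw [mittagLeffler, ← tsum_mul_left, ← tsum_mul_right]
    refine tsum_congr fun k => ?_
    have e : s ^ (p * k + q - 1) = s ^ (q - 1) * (s ^ p) ^ k := by
      rw [← rpow_natCast, ← rpow_mul hs.1.le, ← rpow_add hs.1]
      ring_nf
    simp only [hf]
    rw [e, neg_pow (s ^ p)]
    ring
  have h2 : ∀ k, ∫ s in Ioc 0 t, f k s = (-1) ^ k * c k := fun k => by
    rw [← hbeta]
    simp only [hf]
    rw [integral_const_mul]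
    ring
  rw [setIntegral_congr_fun measurableSet_Ioc h1, ← intervalIntegral.integral_of_le ht.le] at key
  simp only [h2] at key
  refine key.unique ?_
  have h3 := (summable_mittagLeffler hp hq (-t ^ p)).hasSum
  rw [← hasSum_nat_add_iff' 1] at h3
  convert (((h3.mul_left (t ^ (q - 1))).mul_left (Gamma p)).neg) using 1
  · ext k
    simp only [hc]
    rw [neg_pow (t ^ p), pow_succ (-1 : ℝ)]
    ring
  · rw [← mittagLeffler]
    simp only [Finset.sum_range_one, pow_zero, Nat.cast_zero, mul_zero, zero_add]
    ring

theorem continuous_mittagLeffler_neg_rpow {p q : ℝ} (hp : 0 < p) (hq : 0 < q) :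
    Continuous fun s : ℝ => mittagLeffler p q (-s ^ p) :=
  (continuous_mittagLeffler hp hq).comp (continuous_id.rpow_const fun _ => Or.inr hp.le).neg

theorem intervalIntegrable_mittagLeffler_mul_sub_rpow {p q t : ℝ} (hp : 0 < p) (hq : 0 < q)
    (ht : 0 < t) :
    IntervalIntegrable
      (fun s : ℝ => s ^ (q - 1) * mittagLeffler p q (-s ^ p) * (t - s) ^ (p - 1)) volume 0 t := by
  refine ((intervalIntegrable_rpow_mul_sub_rpow hq hp ht).mul_continuousOn
    (continuous_mittagLeffler_neg_rpow hp hq).continuousOn).congr fun s _ => ?_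
  ring

/-- Maximum principle behind the positivity of `E_{p,q}` on the negative half-line: a first zero
`t₀` of `s ↦ E_{p,q}(-s ^ p)` contradicts the Volterra equation satisfied by
`s ^ (q - 1) * E_{p,q}(-s ^ p)` near the maximum of that function to the left of `t₀`. -/
theorem mittagLeffler_neg_rpow_pos {p q : ℝ} (hp : 0 < p) (hp1 : p < 1) (hpq : p ≤ q) {t : ℝ}
    (ht : 0 ≤ t) : 0 < mittagLeffler p q (-t ^ p) := by
  have hq : 0 < q := hp.trans_le hpq
  have hGp := Gamma_pos_of_pos hp
  have hGq := Gamma_pos_of_pos hq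
  have hcont := continuous_mittagLeffler_neg_rpow hp hq
  by_contra! hneg
  obtain ⟨t₀, ⟨ht₀, he₀⟩, hleast⟩ :=
    ((isCompact_Icc (a := 0) (b := t)).inter_right
      (isClosed_le hcont continuous_const)).exists_isLeast ⟨t, ⟨ht, le_rfl⟩, hneg⟩
  simp only [mem_ofPred_eq] at he₀
  have hpos : ∀ s, 0 ≤ s → s < t₀ → 0 < mittagLeffler p q (-s ^ p) := fun s h0 h1 => by
    by_contra! h
    exact h1.not_ge (hleast ⟨⟨h0, h1.le.trans ht₀.2⟩, h⟩)
  have ht₀pos : 0 < t₀ := by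
    refine lt_of_le_of_ne ht₀.1 fun h => ?_
    rw [← h, zero_rpow hp.ne', neg_zero, mittagLeffler_zero_right] at he₀
    exact he₀.not_gt (by positivity)
  set G : ℝ → ℝ := fun s => s ^ (q - 1) * mittagLeffler p q (-s ^ p) with hGdef
  have hGpos : ∀ s, 0 < s → s < t₀ → 0 < G s := fun s h0 h1 =>
    mul_pos (rpow_pos_of_pos h0 _) (hpos s h0.le h1)
  have hG₀ : G t₀ ≤ 0 := mul_nonpos_of_nonneg_of_nonpos (by positivity) he₀
  have hsmall : ∀ᶠ s in nhds t₀, (t₀ / s) ^ (1 - p) * ((t₀ - s) ^ p / p) < Gamma p := by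
    refine ContinuousAt.eventually_lt ?_ continuousAt_const ?_
    · refine ContinuousAt.mul (ContinuousAt.rpow_const ?_ (Or.inr (by linarith)))
        ((ContinuousAt.rpow_const (by fun_prop) (Or.inr hp.le)).div_const _)
      exact continuousAt_const.div continuousAt_id ht₀pos.ne'
    · simpa [zero_rpow hp.ne'] using hGp
  obtain ⟨ε, hε, hεs⟩ := Metric.eventually_nhds_iff.1 hsmall
  set t₁ := max (t₀ / 2) (t₀ - ε / 2) with ht₁
  have ht₁pos : 0 < t₁ := lt_max_of_lt_left (by positivity)
  have ht₁lt : t₁ < t₀ := max_lt (by linarith) (by linarith)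
  have hGc : ContinuousOn G (Icc t₁ t₀) := by
    refine ContinuousOn.mul (fun s hs => ?_) hcont.continuousOn
    exact (continuousAt_rpow_const _ _ (Or.inl (ht₁pos.trans_le hs.1).ne')).continuousWithinAt
  obtain ⟨m, hm, hmax⟩ := isCompact_Icc.exists_isMaxOn ⟨t₁, le_rfl, ht₁lt.le⟩ hGc
  have hGm : 0 < G m := (hGpos _ ht₁pos ht₁lt).trans_le (hmax ⟨le_rfl, ht₁lt.le⟩)
  have hmlt : m < t₀ := lt_of_le_of_ne hm.2 fun h => by rw [h] at hGm; exact hGm.not_ge hG₀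
  have hmpos : 0 < m := ht₁pos.trans_le hm.1
  have hr : (t₀ / m) ^ (1 - p) * ((t₀ - m) ^ p / p) < Gamma p := by
    refine hεs ?_
    rw [dist_comm, dist_eq, abs_of_pos (by linarith)]
    have := (le_max_right (t₀ / 2) (t₀ - ε / 2)).trans hm.1
    linarith
  set r := (t₀ / m) ^ (1 - p) with hrdef
  have hr0 : 0 < r := by positivity
  have hI₀ := intervalIntegrable_mittagLeffler_mul_sub_rpow hp hq ht₀pos
  have hIm := intervalIntegrable_mittagLeffler_mul_sub_rpow hp hq hmpos
  have hI₁ := hI₀.mono_set (c := 0) (d := m) (by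
    rw [uIcc_of_le hmpos.le, uIcc_of_le ht₀pos.le]; exact Icc_subset_Icc_right hmlt.le)
  have hI₂ := hI₀.mono_set (c := m) (d := t₀) (by
    rw [uIcc_of_le hmlt.le, uIcc_of_le ht₀pos.le]; exact Icc_subset_Icc_left hmpos.le)
  have hV₀ := integral_mittagLeffler_mul_sub_rpow hp hq ht₀pos
  have hVm := integral_mittagLeffler_mul_sub_rpow hp hq hmpos
  rw [← intervalIntegral.integral_add_adjacent_intervals hI₁ hI₂] at hV₀
  have hcmp : r * ∫ s in (0 : ℝ)..m, s ^ (q - 1) * mittagLeffler p q (-s ^ p) * (t₀ - s) ^ (p - 1)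
      ≤ ∫ s in (0 : ℝ)..m, s ^ (q - 1) * mittagLeffler p q (-s ^ p) * (m - s) ^ (p - 1) := by
    rw [← intervalIntegral.integral_const_mul]
    refine intervalIntegral.integral_mono_on_of_le_Ioo hmpos.le (hI₁.const_mul r) hIm
      fun s hs => ?_
    have hms : 0 < m - s := sub_pos.2 hs.2
    have hts : 0 < t₀ - s := by linarith
    have hle : r * (t₀ - s) ^ (p - 1) ≤ (m - s) ^ (p - 1) := by
      have h1 : t₀ / m ≤ (t₀ - s) / (m - s) := by
        rw [div_le_div_iff₀ hmpos hms]
        nlinarith [hs.1]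
      have h2 : r ≤ ((t₀ - s) / (m - s)) ^ (1 - p) :=
        rpow_le_rpow (by positivity) h1 (by linarith)
      calc r * (t₀ - s) ^ (p - 1) ≤ ((t₀ - s) / (m - s)) ^ (1 - p) * (t₀ - s) ^ (p - 1) := by
            gcongr
        _ = (m - s) ^ (p - 1) := by
            rw [show p - 1 = -(1 - p) by ring, rpow_neg hts.le, rpow_neg hms.le,
              div_rpow hts.le hms.le]
            field_simp
    have := mul_le_mul_of_nonneg_left hle (hGpos s hs.1 (hs.2.trans hmlt)).le
    simp only [hGdef] at this
    linarith
  have hlast : ∫ s in m..t₀, s ^ (q - 1) * mittagLeffler p q (-s ^ p) * (t₀ - s) ^ (p - 1)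
      ≤ G m * ((t₀ - m) ^ p / p) := by
    have hpow : ∫ s in m..t₀, (t₀ - s) ^ (p - 1) = (t₀ - m) ^ p / p := by
      rw [intervalIntegral.integral_comp_sub_left (fun s => s ^ (p - 1)), sub_self,
        integral_rpow (Or.inl (by linarith)), sub_add_cancel, zero_rpow hp.ne', sub_zero]
    have hpowI : IntervalIntegrable (fun s => (t₀ - s) ^ (p - 1)) volume m t₀ := by
      have h := (intervalIntegral.intervalIntegrable_rpow' (a := t₀ - m) (b := 0)
        (show -1 < p - 1 by linarith)).comp_sub_left t₀
      simpa using h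
    rw [← hpow, ← intervalIntegral.integral_const_mul]
    refine intervalIntegral.integral_mono_on hmlt.le hI₂ (hpowI.const_mul _) fun s hs => ?_
    have : 0 ≤ t₀ - s := sub_nonneg.2 hs.2
    exact mul_le_mul_of_nonneg_right (hmax ⟨hm.1.trans hs.1, hs.2⟩) (by positivity)
  have hh : m ^ (q - 1) ≤ r * t₀ ^ (q - 1) := by
    have h1 : r * t₀ ^ (q - 1) = m ^ (q - 1) * (t₀ / m) ^ (q - p) := by
      rw [hrdef, div_rpow ht₀pos.le hmpos.le, div_rpow ht₀pos.le hmpos.le,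
        show q - p = (1 - p) + (q - 1) by ring, rpow_add ht₀pos, rpow_add hmpos]
      field_simp
    rw [h1]
    refine le_mul_of_one_le_right (by positivity) (one_le_rpow ?_ (by linarith))
    exact (one_le_div hmpos).2 hmlt.le
  rw [hVm] at hcmp
  have hA : Gamma p * (t₀ ^ (q - 1) * (1 / Gamma q)) ≤
      Gamma p * (t₀ ^ (q - 1) * (1 / Gamma q - mittagLeffler p q (-t₀ ^ p))) := by
    gcongr
    linarith
  have hB : Gamma p * (m ^ (q - 1) * (1 / Gamma q)) ≤
      r * (Gamma p * (t₀ ^ (q - 1) * (1 / Gamma q))) := by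
    have := mul_le_mul_of_nonneg_right hh (show 0 ≤ Gamma p * (1 / Gamma q) by positivity)
    linarith
  have hC : r * (Gamma p * (t₀ ^ (q - 1) * (1 / Gamma q)) - G m * ((t₀ - m) ^ p / p)) ≤
      Gamma p * (m ^ (q - 1) * (1 / Gamma q - mittagLeffler p q (-m ^ p))) :=
    (mul_le_mul_of_nonneg_left (by linarith) hr0.le).trans hcmp
  have hD : Gamma p * G m ≤ (r * ((t₀ - m) ^ p / p)) * G m := by
    simp only [hGdef] at hC ⊢
    linarith
  exact (lt_of_mul_lt_mul_right (hD.trans_lt (mul_lt_mul_of_pos_right hr hGm)) hGm.le).false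

theorem mittagLeffler_neg_mem_Icc {p q : ℝ} (hp : 0 < p) (hp1 : p < 1) (hpq : p ≤ q) {x : ℝ}
    (hx : 0 ≤ x) : mittagLeffler p q (-x) ∈ Icc 0 (1 / Gamma q) := by
  have hq : 0 < q := hp.trans_le hpq
  have hpow : ∀ y : ℝ, 0 ≤ y → (y ^ p⁻¹) ^ p = y := fun y hy => rpow_inv_rpow hy hp.ne'
  refine ⟨?_, ?_⟩
  · have := mittagLeffler_neg_rpow_pos hp hp1 hpq (rpow_nonneg hx p⁻¹)
    rw [hpow x hx] at this
    exact this.le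
  · rcases hx.eq_or_lt with rfl | hx
    · rw [neg_zero, mittagLeffler_zero_right]
    have ht : 0 < x ^ p⁻¹ := rpow_pos_of_pos hx _
    have h := integral_mittagLeffler_mul_sub_rpow hp hq ht
    have h0 : 0 ≤ ∫ s in (0 : ℝ)..x ^ p⁻¹,
        s ^ (q - 1) * mittagLeffler p q (-s ^ p) * (x ^ p⁻¹ - s) ^ (p - 1) :=
      intervalIntegral.integral_nonneg ht.le fun s hs => by
        have := (mittagLeffler_neg_rpow_pos hp hp1 hpq hs.1).le
        have := hs.1
        have : 0 ≤ x ^ p⁻¹ - s := sub_nonneg.2 hs.2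
        positivity
    rw [h, hpow x hx.le] at h0
    have := nonneg_of_mul_nonneg_right (nonneg_of_mul_nonneg_right h0 (Gamma_pos_of_pos hp))
      (rpow_pos_of_pos ht _)
    linarith

section ChangeOfVariables

variable {Φ Φ' : ℝ → ℝ} {a b : ℝ}

theorem strictMonoOn_Icc_of_hasDerivAt_pos (hd : ∀ x ∈ Icc a b, HasDerivAt Φ (Φ' x) x)
    (hpos : ∀ x ∈ Icc a b, 0 < Φ' x) : StrictMonoOn Φ (Icc a b) :=
  strictMonoOn_of_deriv_pos (convex_Icc a b) (fun x hx => (hd x hx).continuousAt.continuousWithinAt)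
    fun x hx => by
      rw [(hd x (interior_subset hx)).deriv]
      exact hpos x (interior_subset hx)

theorem intervalIntegrable_and_integral_deriv_mul_comp (hab : a ≤ b)
    (hd : ∀ x ∈ Icc a b, HasDerivAt Φ (Φ' x) x) (hpos : ∀ x ∈ Icc a b, 0 < Φ' x) {g : ℝ → ℝ}
    (hg : IntervalIntegrable g volume (Φ a) (Φ b)) :
    IntervalIntegrable (fun ρ => Φ' ρ * g (Φ ρ)) volume a b ∧
      ∫ ρ in a..b, Φ' ρ * g (Φ ρ) = ∫ u in Φ a..Φ b, g u := by
  have hmono := strictMonoOn_Icc_of_hasDerivAt_pos hd hpos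
  have hle : Φ a ≤ Φ b := hmono.monotoneOn ⟨le_rfl, hab⟩ ⟨hab, le_rfl⟩ hab
  have himg : Φ '' Icc a b = Icc (Φ a) (Φ b) :=
    Subset.antisymm (hmono.monotoneOn.image_Icc_subset)
      (intermediate_value_Icc hab fun x hx => (hd x hx).continuousAt.continuousWithinAt)
  have hdw : ∀ x ∈ Icc a b, HasDerivWithinAt Φ (Φ' x) (Icc a b) x :=
    fun x hx => (hd x hx).hasDerivWithinAt
  have hcongr : EqOn (fun x => |Φ' x| • g (Φ x)) (fun x => Φ' x * g (Φ x)) (Icc a b) :=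
    fun x hx => by simp [abs_of_pos (hpos x hx)]
  rw [intervalIntegrable_iff_integrableOn_Icc_of_le hle, ← himg,
    integrableOn_image_iff_integrableOn_abs_deriv_smul measurableSet_Icc hdw hmono.injOn,
    integrableOn_congr_fun hcongr measurableSet_Icc] at hg
  refine ⟨(intervalIntegrable_iff_integrableOn_Icc_of_le hab).2 hg, ?_⟩
  rw [intervalIntegral.integral_of_le hab, intervalIntegral.integral_of_le hle,
    ← integral_Icc_eq_integral_Ioc, ← integral_Icc_eq_integral_Ioc, ← himg,
    integral_image_eq_integral_abs_deriv_smul measurableSet_Icc hdw hmono.injOn,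
    setIntegral_congr_fun measurableSet_Icc hcongr]

theorem intervalIntegrable_and_integral_fractional_rpow (hab : a ≤ b)
    (hd : ∀ x ∈ Icc a b, HasDerivAt Φ (Φ' x) x) (hpos : ∀ x ∈ Icc a b, 0 < Φ' x) {μ r : ℝ}
    (hμ : 0 < μ) (hr : 0 ≤ r) :
    IntervalIntegrable
        (fun ρ => Φ' ρ * ((Φ b - Φ ρ) ^ (μ - 1) / Gamma μ * ((Φ ρ - Φ a) ^ r / Gamma (r + 1))))
        volume a b ∧
      ∫ ρ in a..b, Φ' ρ * ((Φ b - Φ ρ) ^ (μ - 1) / Gamma μ * ((Φ ρ - Φ a) ^ r / Gamma (r + 1))) =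
        (Φ b - Φ a) ^ (μ + r) / Gamma (μ + r + 1) := by
  rcases hab.eq_or_lt with rfl | hlt
  · simp [zero_rpow (show μ + r ≠ 0 by positivity)]
  have hΦ : 0 < Φ b - Φ a := sub_pos.2 <| strictMonoOn_Icc_of_hasDerivAt_pos hd hpos
    ⟨le_rfl, hab⟩ ⟨hab, le_rfl⟩ hlt
  have hr1 : 0 < r + 1 := by positivity
  have hG1 := (Gamma_pos_of_pos hμ).ne'
  have hG2 := (Gamma_pos_of_pos hr1).ne'
  set c : ℝ := 1 / (Gamma μ * Gamma (r + 1)) with hc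
  set h : ℝ → ℝ := fun s => c * (s ^ (r + 1 - 1) * ((Φ b - Φ a) - s) ^ (μ - 1)) with hh
  have hhi : IntervalIntegrable h volume 0 (Φ b - Φ a) :=
    (intervalIntegrable_rpow_mul_sub_rpow hr1 hμ hΦ).const_mul c
  have hgi : IntervalIntegrable (fun u => h (u - Φ a)) volume (Φ a) (Φ b) := by
    simpa using hhi.comp_sub_right (Φ a)
  have heq : ∀ ρ, Φ' ρ * ((Φ b - Φ ρ) ^ (μ - 1) / Gamma μ * ((Φ ρ - Φ a) ^ r / Gamma (r + 1))) =
      Φ' ρ * h (Φ ρ - Φ a) := fun ρ => by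
    simp only [hh, hc, add_sub_cancel_right, sub_sub_sub_cancel_right]
    field_simp
  simp only [heq]
  obtain ⟨h1, h2⟩ := intervalIntegrable_and_integral_deriv_mul_comp hab hd hpos hgi
  refine ⟨h1, h2.trans ?_⟩
  rw [intervalIntegral.integral_comp_sub_right h, sub_self]
  simp only [hh]
  rw [intervalIntegral.integral_const_mul, integral_rpow_mul_sub_rpow hr1 hμ hΦ, hc,
    show r + 1 + μ - 1 = μ + r by ring, show r + 1 + μ = μ + r + 1 by ring]
  field_simp

/-- Grönwall inequality for the fractional integral of order `μ` with respect to `Φ`. -/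
theorem le_mul_mittagLeffler_of_le_add_fractional_integral (hab : a ≤ b)
    (hd : ∀ x ∈ Icc a b, HasDerivAt Φ (Φ' x) x) (hpos : ∀ x ∈ Icc a b, 0 < Φ' x) {μ L A B : ℝ}
    (hμ : 0 < μ) (hL : 0 ≤ L) (hA : 0 ≤ A) (hB : 0 ≤ B) {y : ℝ → ℝ} {M : ℝ}
    (hM : ∀ ℓ ∈ Icc a b, y ℓ ≤ M)
    (hy : ∀ ℓ ∈ Icc a b, ∀ u : ℝ → ℝ, (∀ ρ ∈ Icc a ℓ, y ρ ≤ u ρ) →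
      IntervalIntegrable (fun ρ => Φ' ρ * ((Φ ℓ - Φ ρ) ^ (μ - 1) / Gamma μ * (B + L * u ρ)))
        volume a ℓ →
      y ℓ ≤ A + ∫ ρ in a..ℓ, Φ' ρ * ((Φ ℓ - Φ ρ) ^ (μ - 1) / Gamma μ * (B + L * u ρ))) :
    ∀ ℓ ∈ Icc a b, y ℓ ≤ (A + B * (Φ b - Φ a) ^ μ / Gamma (μ + 1)) *
      mittagLeffler μ 1 (L * (Φ b - Φ a) ^ μ) := by
  have hmono := (strictMonoOn_Icc_of_hasDerivAt_pos hd hpos).monotoneOn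
  set C := A + B * (Φ b - Φ a) ^ μ / Gamma (μ + 1) with hC
  have hG : ∀ k : ℕ, 0 < Gamma (μ * k + 1) := fun k => Gamma_pos_of_pos (by positivity)
  have hG1 : 0 < Gamma (μ + 1) := Gamma_pos_of_pos (by positivity)
  have hiter : ∀ n : ℕ, ∀ ℓ ∈ Icc a b, y ℓ ≤
      ∑ k ∈ Finset.range n, C * L ^ k * ((Φ ℓ - Φ a) ^ (μ * k) / Gamma (μ * k + 1)) +
        M * L ^ n * ((Φ ℓ - Φ a) ^ (μ * n) / Gamma (μ * n + 1)) := by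
    intro n
    induction n with
    | zero => simpa using hM
    | succ n ih =>
      intro ℓ hℓ
      have hd' : ∀ x ∈ Icc a ℓ, HasDerivAt Φ (Φ' x) x := fun x hx => hd x ⟨hx.1, hx.2.trans hℓ.2⟩
      have hpos' : ∀ x ∈ Icc a ℓ, 0 < Φ' x := fun x hx => hpos x ⟨hx.1, hx.2.trans hℓ.2⟩
      set w : ℕ → ℝ → ℝ := fun k ρ => Φ' ρ * ((Φ ℓ - Φ ρ) ^ (μ - 1) / Gamma μ *
        ((Φ ρ - Φ a) ^ (μ * k) / Gamma (μ * k + 1))) with hw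
      have hI : ∀ k : ℕ, IntervalIntegrable (fun ρ => w k ρ) volume a ℓ ∧ ∫ ρ in a..ℓ, w k ρ =
          (Φ ℓ - Φ a) ^ (μ + μ * k) / Gamma (μ + μ * k + 1) := fun k =>
        intervalIntegrable_and_integral_fractional_rpow hℓ.1 hd' hpos' hμ
          (show 0 ≤ μ * k by positivity)
      have hexp : (fun ρ => Φ' ρ * ((Φ ℓ - Φ ρ) ^ (μ - 1) / Gamma μ * (B + L *
          (∑ k ∈ Finset.range n, C * L ^ k * ((Φ ρ - Φ a) ^ (μ * k) / Gamma (μ * k + 1)) +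
            M * L ^ n * ((Φ ρ - Φ a) ^ (μ * n) / Gamma (μ * n + 1)))))) =
          fun ρ => B * w 0 ρ + (∑ k ∈ Finset.range n, C * L ^ (k + 1) * w k ρ +
            M * L ^ (n + 1) * w n ρ) := by
        ext ρ
        have h0 : w 0 ρ = Φ' ρ * ((Φ ℓ - Φ ρ) ^ (μ - 1) / Gamma μ) := by simp [hw]
        rw [h0, mul_add L, Finset.mul_sum, mul_add, mul_add, mul_add, mul_add, Finset.mul_sum,
          Finset.mul_sum]
        simp only [hw, pow_succ]
        congr 1
        · ring
        · congr 1
          · exact Finset.sum_congr rfl fun k _ => by ring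
          · ring
      have hint0 := (hI 0).1.const_mul B
      have hints : IntervalIntegrable (fun ρ => ∑ k ∈ Finset.range n, C * L ^ (k + 1) * w k ρ)
          volume a ℓ := by
        have := IntervalIntegrable.sum (Finset.range n)
          fun k _ => (hI k).1.const_mul (C * L ^ (k + 1))
        exact this.congr fun ρ _ => by simp [hw]
      have hintn := (hI n).1.const_mul (M * L ^ (n + 1))
      have h := hy ℓ hℓ _ (fun ρ hρ => ih ρ ⟨hρ.1, hρ.2.trans hℓ.2⟩)
        (by rw [hexp]; exact hint0.add (hints.add hintn))
      rw [hexp, intervalIntegral.integral_add hint0 (hints.add hintn),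
        intervalIntegral.integral_add hints hintn, intervalIntegral.integral_const_mul,
        intervalIntegral.integral_const_mul,
        intervalIntegral.integral_finsetSum fun k _ => (hI k).1.const_mul _] at h
      simp only [intervalIntegral.integral_const_mul] at h
      have hval : ∀ k : ℕ, ∫ ρ in a..ℓ, w k ρ =
          (Φ ℓ - Φ a) ^ (μ * (k + 1 : ℕ)) / Gamma (μ * (k + 1 : ℕ) + 1) := fun k => by
        rw [(hI k).2]
        push_cast
        ring_nf
      simp_rw [hval] at h
      rw [Finset.sum_range_succ']
      have hℓΦ : 0 ≤ Φ ℓ - Φ a := sub_nonneg.2 (hmono ⟨le_rfl, hab⟩ hℓ hℓ.1)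
      have hCle : A + B * ((Φ ℓ - Φ a) ^ (μ * (0 + 1 : ℕ)) / Gamma (μ * (0 + 1 : ℕ) + 1)) ≤ C := by
        have hle : Φ ℓ - Φ a ≤ Φ b - Φ a := by
          have := hmono hℓ ⟨hab, le_rfl⟩ hℓ.2
          linarith
        rw [hC, mul_div_assoc]
        simp only [zero_add, Nat.cast_one, mul_one]
        gcongr
      have hz0 : C * L ^ 0 * ((Φ ℓ - Φ a) ^ (μ * (0 : ℕ)) / Gamma (μ * (0 : ℕ) + 1)) = C := by simp
      rw [hz0]
      linarith
  intro ℓ hℓ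
  have hℓΦ : 0 ≤ Φ ℓ - Φ a := sub_nonneg.2 (hmono ⟨le_rfl, hab⟩ hℓ hℓ.1)
  have hle : Φ ℓ - Φ a ≤ Φ b - Φ a := by
    have := hmono hℓ ⟨hab, le_rfl⟩ hℓ.2
    linarith
  have hbΦ : 0 ≤ Φ b - Φ a := hℓΦ.trans hle
  have hC0 : 0 ≤ C := by positivity
  have hs := summable_mittagLeffler hμ one_pos (L * (Φ b - Φ a) ^ μ)
  have hterm : ∀ k : ℕ, L ^ k * ((Φ ℓ - Φ a) ^ (μ * k) / Gamma (μ * k + 1)) ≤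
      (L * (Φ b - Φ a) ^ μ) ^ k / Gamma (μ * k + 1) := fun k => by
    rw [mul_pow, ← rpow_natCast ((Φ b - Φ a) ^ μ), ← rpow_mul hbΦ, mul_div_assoc]
    have := hG k
    gcongr
  have hlim : Filter.Tendsto (fun n : ℕ =>
      C * ∑ k ∈ Finset.range n, (L * (Φ b - Φ a) ^ μ) ^ k / Gamma (μ * k + 1) +
        |M| * ((L * (Φ b - Φ a) ^ μ) ^ n / Gamma (μ * n + 1))) Filter.atTop
      (nhds (C * mittagLeffler μ 1 (L * (Φ b - Φ a) ^ μ) + |M| * 0)) :=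
    (hs.hasSum.tendsto_sum_nat.const_mul C).add (hs.tendsto_atTop_zero.const_mul |M|)
  rw [mul_zero, add_zero] at hlim
  refine ge_of_tendsto' hlim fun n => (hiter n ℓ hℓ).trans ?_
  rw [Finset.mul_sum]
  refine add_le_add (Finset.sum_le_sum fun k _ => ?_) ?_
  · rw [mul_assoc]
    exact mul_le_mul_of_nonneg_left (hterm k) hC0
  · rw [mul_assoc]
    have := hG n
    exact mul_le_mul (le_abs_self M) (hterm n) (by positivity) (abs_nonneg M)

end ChangeOfVariables

/-- A priori estimate: any continuous solution of the integral
equation equivalent to the Cauchy problem satisfies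
`|z(ℓ)| ≤ (|z_a| + F*(Φ(b)−Φ(a))^μ/Γ(μ+1)) E_μ(L(Φ(b)−Φ(a))^μ)`,
where `F* = sup_{ℓ∈[a,b]} |F(ℓ,0)|`. -/
theorem a_priori_estimate
    (a b : ℝ) (hab : a < b)
    (Φ Φ' : ℝ → ℝ)
    (hΦd : ∀ x ∈ Icc a b, HasDerivAt Φ (Φ' x) x)
    (hΦ'c : ContinuousOn Φ' (Icc a b))
    (hΦ'pos : ∀ x ∈ Icc a b, 0 < Φ' x)
    (μ κ ω za : ℝ) (hκ0 : 0 < κ) (hκμ : κ < μ) (hμ1 : μ < 1) (hω : 0 < ω)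
    (F : ℝ → ℝ → ℝ)
    (hFc : ContinuousOn (fun p : ℝ × ℝ => F p.1 p.2) (Icc a b ×ˢ (univ : Set ℝ)))
    (L : ℝ) (hL : 0 < L)
    (hlip : ∀ ℓ ∈ Icc a b, ∀ x y : ℝ, |F ℓ y - F ℓ x| ≤ L * |y - x|)
    (Fstar : ℝ) (hFstar : Fstar = ⨆ ℓ : Icc a b, |F (ℓ : ℝ) 0|)
    (z : ℝ → ℝ) (hzc : ContinuousOn z (Icc a b))
    (hz : ∀ ℓ ∈ Icc a b,
      z ℓ = za + ∫ ρ in a..ℓ,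
        Φ' ρ * (Φ ℓ - Φ ρ) ^ (μ - 1) *
          mittagLeffler (μ - κ) μ (-ω * (Φ ℓ - Φ ρ) ^ (μ - κ)) * F ρ (z ρ)) :
    ∀ ℓ ∈ Icc a b,
      |z ℓ| ≤ (|za| + Fstar * (Φ b - Φ a) ^ μ / Real.Gamma (μ + 1)) *
        mittagLeffler μ 1 (L * (Φ b - Φ a) ^ μ) := by

  have hμ0 : 0 < μ := hκ0.trans hκμ
  have hGμ := Gamma_pos_of_pos hμ0
  have hmono := (strictMonoOn_Icc_of_hasDerivAt_pos hΦd hΦ'pos).monotoneOn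
  have hF0 : ∀ ρ ∈ Icc a b, |F ρ 0| ≤ Fstar := fun ρ hρ => by
    have hc : ContinuousOn (fun ρ => |F ρ 0|) (Icc a b) :=
      (hFc.comp (f := fun ρ => (ρ, (0 : ℝ))) (by fun_prop) fun x hx => ⟨hx, mem_univ _⟩).abs
    have hbdd : BddAbove (range fun ℓ : Icc a b => |F (ℓ : ℝ) 0|) := by
      have := (isCompact_Icc.image_of_continuousOn hc).bddAbove
      rwa [image_eq_range] at this
    rw [hFstar]
    exact le_ciSup hbdd (⟨ρ, hρ⟩ : Icc a b)
  have hFstar0 : 0 ≤ Fstar := (abs_nonneg _).trans (hF0 a ⟨le_rfl, hab.le⟩)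
  obtain ⟨M, hM⟩ := isCompact_Icc.exists_bound_of_continuousOn hzc
  refine le_mul_mittagLeffler_of_le_add_fractional_integral hab.le hΦd hΦ'pos hμ0 hL.le
    (abs_nonneg za) hFstar0 (y := fun ℓ => |z ℓ|) hM fun ℓ hℓ u hu hint => ?_
  rw [hz ℓ hℓ]
  refine (abs_add_le _ _).trans (add_le_add le_rfl ?_)
  rw [← norm_eq_abs]
  refine intervalIntegral.norm_integral_le_of_norm_le hℓ.1 (Filter.Eventually.of_forall
    fun ρ hρ => ?_) hint
  have hρb : ρ ∈ Icc a b := ⟨hρ.1.le, hρ.2.trans hℓ.2⟩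
  have hΦρ : 0 ≤ Φ ℓ - Φ ρ := sub_nonneg.2 (hmono hρb hℓ hρ.2)
  have hE := mittagLeffler_neg_mem_Icc (p := μ - κ) (q := μ) (by linarith) (by linarith)
    (by linarith) (show 0 ≤ ω * (Φ ℓ - Φ ρ) ^ (μ - κ) by positivity)
  have hFz : |F ρ (z ρ)| ≤ Fstar + L * u ρ := by
    have h1 := hlip ρ hρb 0 (z ρ)
    rw [sub_zero] at h1
    have h2 := abs_sub_abs_le_abs_sub (F ρ (z ρ)) (F ρ 0)
    have h3 := mul_le_mul_of_nonneg_left (hu ρ ⟨hρ.1.le, hρ.2⟩) hL.le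
    linarith [hF0 ρ hρb]
  have hΦ'ρ := hΦ'pos ρ hρb
  rw [neg_mul, norm_mul, norm_mul, norm_of_nonneg (by positivity), norm_of_nonneg hE.1, norm_eq_abs]
  calc _ ≤ Φ' ρ * (Φ ℓ - Φ ρ) ^ (μ - 1) * (1 / Gamma μ) * (Fstar + L * u ρ) := by
        gcongr
        exact hE.2
    _ = _ := by ring
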